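/- Let D > 1 and B₁, C₁ ∈ ℝ. Then there exist ε₀ > 0 and K > 0 such that for every ε ∈ (0, ε₀), with B = εB₁ and C = εC₁, there exists A_HH(ε) satisfying |A_HH(ε) − 2/3 − ε(2√2/(3√3) − (B₁ + √3 C₁))| ≤ Kε², together with an equilibrium value ū(ε) solving ū³ − ū(1 − A_HH(ε) − B) + C = 0 with |ū(ε) − 1/√3| ≤ Kε, such that the characteristic polynomial p(λ) = (λ² − (3ū² − 1))(λ² − ε²)(D²λ² − ε²) + A_HH(ε)ε²(D²λ² − ε²) + B D²ε²(λ² − ε²) has a purely imaginary root of algebraic multiplicity two (a Hamiltonian–Hopf configuration, corresponding to a Turing instability). The analogous statement holds with the sign choice ū(ε) near −1/√3 and the curve A_HH(ε) = 2/3 + ε(2√2/(3√3) − (B₁ − √3 C₁)) + O(ε²). -/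

import Mathlib

open Real Filter

/-- The characteristic polynomial (over `ℂ`) of the linearisation of the stationary
three-component system about the equilibrium `(ū, 0, ū, 0, ū, 0)`:
`p(λ) = (λ² − (3ū² − 1))(λ² − ε²)(D²λ² − ε²) + Aε²(D²λ² − ε²) + BD²ε²(λ² − ε²)`. -/
noncomputable def charPoly (ε A B D u : ℝ) : Polynomial ℂ :=
  (Polynomial.X ^ 2 - Polynomial.C ((3 * u ^ 2 - 1 : ℝ) : ℂ)) *
      (Polynomial.X ^ 2 - Polynomial.C ((ε ^ 2 : ℝ) : ℂ)) *
      (Polynomial.C ((D ^ 2 : ℝ) : ℂ) * Polynomial.X ^ 2 - Polynomial.C ((ε ^ 2 : ℝ) : ℂ)) +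
    Polynomial.C ((A * ε ^ 2 : ℝ) : ℂ) *
      (Polynomial.C ((D ^ 2 : ℝ) : ℂ) * Polynomial.X ^ 2 - Polynomial.C ((ε ^ 2 : ℝ) : ℂ)) +
    Polynomial.C ((B * D ^ 2 * ε ^ 2 : ℝ) : ℂ) *
      (Polynomial.X ^ 2 - Polynomial.C ((ε ^ 2 : ℝ) : ℂ))

/-- A negative number `-μ²` that is a double, but not a triple, root of `charPoly` regarded as a
cubic in `λ²` gives a double root `iμ` of `charPoly`. -/
lemma rootMultiplicity_charPoly {ε A B D u μ : ℝ} (hμ : μ ≠ 0)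
    (h0 : (μ ^ 2 + (3 * u ^ 2 - 1)) * (μ ^ 2 + ε ^ 2) * (D ^ 2 * μ ^ 2 + ε ^ 2)
      + A * ε ^ 2 * (D ^ 2 * μ ^ 2 + ε ^ 2) + B * D ^ 2 * ε ^ 2 * (μ ^ 2 + ε ^ 2) = 0)
    (h1 : (μ ^ 2 + ε ^ 2) * (D ^ 2 * μ ^ 2 + ε ^ 2)
      + (μ ^ 2 + (3 * u ^ 2 - 1)) * (D ^ 2 * μ ^ 2 + ε ^ 2)
      + (μ ^ 2 + (3 * u ^ 2 - 1)) * (μ ^ 2 + ε ^ 2) * D ^ 2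
      + A * ε ^ 2 * D ^ 2 + B * D ^ 2 * ε ^ 2 = 0)
    (h2 : D ^ 2 * (3 * μ ^ 2 + (3 * u ^ 2 - 1)) + (D ^ 2 + 1) * ε ^ 2 ≠ 0) :
    Polynomial.rootMultiplicity (Complex.I * (μ : ℂ)) (charPoly ε A B D u) = 2 := by
  set a : ℂ := Complex.I * (μ : ℂ) with ha
  have ha2 : a ^ 2 = -(μ : ℂ) ^ 2 := by rw [ha, mul_pow, Complex.I_sq]; ring
  have ha0 : a ≠ 0 := mul_ne_zero Complex.I_ne_zero (by exact_mod_cast hμ)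
  set e : ℝ := -(D ^ 2 * (3 * u ^ 2 - 1) + (D ^ 2 + 1) * ε ^ 2 + 2 * μ ^ 2 * D ^ 2) with he
  set Q : Polynomial ℂ := (Polynomial.X + Polynomial.C a) ^ 2 *
    (Polynomial.C ((D ^ 2 : ℝ) : ℂ) * Polynomial.X ^ 2 + Polynomial.C ((e : ℝ) : ℂ)) with hQ
  have hQa : Q.eval a ≠ 0 := by
    have : Q.eval a = (2 * a) ^ 2 * ((-(D ^ 2 * (3 * μ ^ 2 + (3 * u ^ 2 - 1))
        + (D ^ 2 + 1) * ε ^ 2) : ℝ) : ℂ) := by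
      simp only [hQ, he, Polynomial.eval_mul, Polynomial.eval_pow, Polynomial.eval_add,
        Polynomial.eval_X, Polynomial.eval_C, ha2]
      push_cast
      ring
    rw [this]
    refine mul_ne_zero (pow_ne_zero _ (mul_ne_zero two_ne_zero ha0)) ?_
    exact_mod_cast neg_ne_zero.mpr h2
  have hfac : charPoly ε A B D u = (Polynomial.X - Polynomial.C a) ^ 2 * Q := by
    have hC : (Polynomial.C a) ^ 2 = -(Polynomial.C (μ : ℂ)) ^ 2 := by
      rw [← Polynomial.C_pow, ha2, Polynomial.C_neg, Polynomial.C_pow]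
    have k0 := congrArg (fun x : ℝ => Polynomial.C (x : ℂ)) h0
    have k1 := congrArg (fun x : ℝ => Polynomial.C (x : ℂ)) h1
    have hQ' : (Polynomial.X - Polynomial.C a) ^ 2 * Q
        = (Polynomial.X ^ 2 + Polynomial.C (μ : ℂ) ^ 2) ^ 2 *
    (Polynomial.C ((D ^ 2 : ℝ) : ℂ) * Polynomial.X ^ 2 + Polynomial.C ((e : ℝ) : ℂ)) := by
      have : (Polynomial.X ^ 2 + Polynomial.C (μ : ℂ) ^ 2 : Polynomial ℂ)
          = (Polynomial.X - Polynomial.C a) * (Polynomial.X + Polynomial.C a) := by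
        linear_combination hC
      rw [this, hQ]; ring
    rw [hQ', charPoly, he]
    simp only [Complex.ofReal_add, Complex.ofReal_mul, Complex.ofReal_pow, Complex.ofReal_sub,
      Complex.ofReal_neg, map_add, map_mul, map_pow, map_sub, map_neg, Complex.ofReal_one,
      Complex.ofReal_zero, map_zero, map_one, Complex.ofReal_ofNat, map_ofNat] at k0 k1 ⊢
    linear_combination (Polynomial.X ^ 2 + Polynomial.C (μ : ℂ) ^ 2) * k1 - k0
  have hQ0 : Q ≠ 0 := fun h => hQa (by simp [h])
  have hX : (Polynomial.X - Polynomial.C a) ^ 2 ≠ 0 := pow_ne_zero _ (Polynomial.X_sub_C_ne_zero a)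
  rw [hfac, Polynomial.rootMultiplicity_mul (mul_ne_zero hX hQ0),
    Polynomial.rootMultiplicity_X_sub_C_pow, Polynomial.rootMultiplicity_eq_zero hQa]

/-- A map that is `C¹` at `(0, y₀)` is Lipschitz on a box around `(0, y₀)`. -/
lemma ContDiffAt.exists_lipschitz_box {E : Type*} [NormedAddCommGroup E] [NormedSpace ℝ E]
    {f : ℝ × ℝ → E} {y₀ : ℝ} (hf : ContDiffAt ℝ 1 f (0, y₀)) :
    ∃ L > (0 : ℝ), ∃ r > (0 : ℝ), ∀ ε y ε' y', |ε| < r → |y - y₀| < r → |ε'| < r → |y' - y₀| < r →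
      ‖f (ε, y) - f (ε', y')‖ ≤ L * (|ε - ε'| + |y - y'|) := by
  obtain ⟨K, t, ht, hK⟩ := hf.exists_lipschitzOnWith
  obtain ⟨r, hr, hrt⟩ := Metric.mem_nhds_iff.mp ht
  have hmem : ∀ ε y : ℝ, |ε| < r → |y - y₀| < r → (ε, y) ∈ t := fun ε y h1 h2 =>
    hrt (by simp [Prod.dist_eq, Real.dist_eq, h1, h2])
  refine ⟨K + 1, by positivity, r, hr, fun ε y ε' y' h1 h2 h3 h4 => ?_⟩
  have h := hK.dist_le_mul _ (hmem ε y h1 h2) _ (hmem ε' y' h3 h4)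
  rw [dist_eq_norm, Prod.dist_eq, Real.dist_eq, Real.dist_eq] at h
  refine h.trans (mul_le_mul (by linarith) (max_le ?_ ?_) (by positivity) (by positivity))
  · linarith [abs_nonneg (y - y')]
  · linarith [abs_nonneg (ε - ε')]

/-- The value of `A` for which `-εy` is a critical point of `charPoly` in the variable `λ²`,
up to the choice of the equilibrium. -/
noncomputable def hopfA (D B₁ ε y : ℝ) : ℝ :=
  (y + ε) ^ 2 * (1 - ε * B₁ * D ^ 4 / (D ^ 2 * y + ε) ^ 2)

/-- The value of `(3ū² - 1) / ε` for which `-εy` is a root of `charPoly` in the variable `λ²`,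
when `A = hopfA D B₁ ε y`. -/
noncomputable def hopfF (D B₁ ε y : ℝ) : ℝ :=
  -(y + (y + ε) * (1 - ε * B₁ * D ^ 4 / (D ^ 2 * y + ε) ^ 2) + ε * B₁ * D ^ 2 / (D ^ 2 * y + ε))

/-- The positive equilibrium value with `3ū² - 1 = ε * hopfF D B₁ ε y`. -/
noncomputable def hopfU (D B₁ ε y : ℝ) : ℝ := √((1 + ε * hopfF D B₁ ε y) / 3)

/-- The equilibrium equation divided by `ū`. -/
noncomputable def hopfH (D B₁ C₁ ε y : ℝ) : ℝ :=
  (1 + ε * hopfF D B₁ ε y) / 3 - 1 + hopfA D B₁ ε y + ε * B₁ + ε * C₁ * (hopfU D B₁ ε y)⁻¹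

lemma contDiffAt_hopf {D y₀ : ℝ} (B₁ C₁ : ℝ) (hD : 0 < D) (hy₀ : 0 < y₀) :
    ContDiffAt ℝ 1 (fun p : ℝ × ℝ => (hopfF D B₁ p.1 p.2, hopfU D B₁ p.1 p.2,
      (hopfU D B₁ p.1 p.2)⁻¹, hopfH D B₁ C₁ p.1 p.2)) (0, y₀) := by
  have hne : D ^ 2 * y₀ + 0 ≠ 0 := by positivity
  have hne2 : (D ^ 2 * y₀ + 0) ^ 2 ≠ 0 := pow_ne_zero _ hne
  have hq : ContDiffAt ℝ 1 (fun p : ℝ × ℝ =>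
      1 - p.1 * B₁ * D ^ 4 / (D ^ 2 * p.2 + p.1) ^ 2) (0, y₀) := by
    refine contDiffAt_const.sub (ContDiffAt.div ?_ ?_ hne2) <;> fun_prop
  have hq' : ContDiffAt ℝ 1 (fun p : ℝ × ℝ =>
      p.1 * B₁ * D ^ 2 / (D ^ 2 * p.2 + p.1)) (0, y₀) := by
    refine ContDiffAt.div ?_ ?_ hne <;> fun_prop
  have hA : ContDiffAt ℝ 1 (fun p : ℝ × ℝ => hopfA D B₁ p.1 p.2) (0, y₀) := by
    unfold hopfA
    exact ContDiffAt.mul (by fun_prop) hq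
  have hF : ContDiffAt ℝ 1 (fun p : ℝ × ℝ => hopfF D B₁ p.1 p.2) (0, y₀) := by
    unfold hopfF
    exact ((contDiffAt_snd.add (ContDiffAt.mul (by fun_prop) hq)).add hq').neg
  have hU : ContDiffAt ℝ 1 (fun p : ℝ × ℝ => hopfU D B₁ p.1 p.2) (0, y₀) := by
    unfold hopfU
    refine ContDiffAt.sqrt (by fun_prop) ?_
    simp
  have hW : ContDiffAt ℝ 1 (fun p : ℝ × ℝ => (hopfU D B₁ p.1 p.2)⁻¹) (0, y₀) := by
    refine hU.inv ?_
    simp [hopfU]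
  refine hF.prodMk (hU.prodMk (hW.prodMk ?_))
  unfold hopfH
  fun_prop

/-- At the parameters `hopfA`, `hopfU`, the number `i√(εy)` is a double root of `charPoly`. -/
lemma rootMultiplicity_charPoly_hopf {D B₁ ε y u : ℝ} (hD : 0 < D) (hε : 0 < ε) (hy : 0 < y)
    (hu : 3 * u ^ 2 - 1 = ε * hopfF D B₁ ε y) (hF : 0 < 3 * y + hopfF D B₁ ε y) :
    Polynomial.rootMultiplicity (Complex.I * ((√(ε * y) : ℝ) : ℂ))
      (charPoly ε (hopfA D B₁ ε y) (ε * B₁) D u) = 2 := by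
  have hsq : √(ε * y) ^ 2 = ε * y := Real.sq_sqrt (by positivity)
  have hd : D ^ 2 * y + ε ≠ 0 := by positivity
  apply rootMultiplicity_charPoly
  · positivity
  · rw [hsq, hu, hopfF, hopfA]
    field_simp
    ring
  · rw [hsq, hu, hopfF, hopfA]
    field_simp
    ring
  · rw [hsq, hu]
    have : 0 < D ^ 2 * (ε * (3 * y + hopfF D B₁ ε y)) := by positivity
    have : 0 < (D ^ 2 + 1) * ε ^ 2 := by positivity
    intro h
    nlinarith

/-- The curve of double roots near the equilibrium `1/√3`. -/
lemma exists_hopf_curve (D B₁ C₁ : ℝ) (hD : 0 < D) :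
    ∃ ε₀ > (0 : ℝ), ∃ K > (0 : ℝ), ∀ ε : ℝ, 0 < ε → ε < ε₀ → ∃ A u : ℝ,
      |A - 2 / 3 - ε * (2 * √2 / (3 * √3) - (B₁ + √3 * C₁))| ≤ K * ε ^ 2 ∧
      u ^ 3 - u * (1 - A - ε * B₁) + ε * C₁ = 0 ∧
      |u - 1 / √3| ≤ K * ε ∧
      ∃ μ : ℝ, μ ≠ 0 ∧ ∀ v : ℝ, v ^ 2 = u ^ 2 →
        Polynomial.rootMultiplicity (Complex.I * (μ : ℂ)) (charPoly ε A (ε * B₁) D v) = 2 := by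
  set y₀ : ℝ := √2 / √3 with hy₀
  have hy₀sq : y₀ ^ 2 = 2 / 3 := by rw [hy₀, div_pow]; norm_num
  have hy₀pos : 0 < y₀ := by positivity
  have hy₀1 : y₀ < 1 := by nlinarith
  have hy₀2 : 4 / 5 < y₀ := by nlinarith
  obtain ⟨L, hL, r, hr, hLip⟩ := (contDiffAt_hopf B₁ C₁ hD hy₀pos).exists_lipschitz_box
  set M : ℝ := 2 * L + 1 with hM
  set N : ℝ := L * (1 + M) with hN
  have hNpos : 0 < N := by positivity
  refine ⟨min (r / (1 + M)) (1 / (10 * (1 + M + N))), by positivity, N * (1 + |C₁|), by positivity,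
    fun ε hε hε₀ => ?_⟩
  have hε1 : ε * (1 + M) < r := (lt_div_iff₀ (by positivity)).mp (hε₀.trans_le (min_le_left _ _))
  have hε2 : ε * (10 * (1 + M + N)) < 1 :=
    (lt_div_iff₀ (by positivity)).mp (hε₀.trans_le (min_le_right _ _))
  have hMpos : 0 < M * ε := by positivity
  have hNε : 0 < N * ε := by positivity
  have hεr : |ε| < r := by rw [abs_of_pos hε]; linarith
  have hyr : ∀ y ∈ Set.Icc (y₀ - M * ε) (y₀ + M * ε), |y - y₀| < r := fun y hy => by
    rw [abs_lt]; constructor <;> linarith [hy.1, hy.2]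
  have hH0 : ∀ y, hopfH D B₁ C₁ 0 y = y ^ 2 - 2 / 3 := fun y => by
    simp only [hopfH, hopfA]; ring
  have hHle : ∀ y ∈ Set.Icc (y₀ - M * ε) (y₀ + M * ε),
      |hopfH D B₁ C₁ ε y - (y ^ 2 - 2 / 3)| ≤ L * ε := fun y hy => by
    have h := hLip ε y 0 y hεr (hyr y hy) (by simpa using hr) (hyr y hy)
    have h' := (norm_snd_le _).trans ((norm_snd_le _).trans ((norm_snd_le _).trans h))
    simp only [Prod.snd_sub, sub_self, sub_zero, abs_zero, add_zero, abs_of_pos hε] at h'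
    rwa [hH0 y, Real.norm_eq_abs] at h'
  have hcont : ContinuousOn (fun y => hopfH D B₁ C₁ ε y)
      (Set.Icc (y₀ - M * ε) (y₀ + M * ε)) := by
    refine (LipschitzOnWith.of_dist_le_mul (K := ⟨L, hL.le⟩) fun y hy y' hy' => ?_).continuousOn
    have h := hLip ε y ε y' hεr (hyr y hy) hεr (hyr y' hy')
    have h' := (norm_snd_le _).trans ((norm_snd_le _).trans ((norm_snd_le _).trans h))
    simp only [Prod.snd_sub, sub_self, abs_zero, zero_add] at h'
    exact h'
  have hle : y₀ - M * ε ≤ y₀ + M * ε := by linarith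
  have hlo : hopfH D B₁ C₁ ε (y₀ - M * ε) ≤ 0 := by
    have h := (abs_le.mp (hHle _ (Set.left_mem_Icc.mpr hle))).2
    nlinarith
  have hhi : 0 ≤ hopfH D B₁ C₁ ε (y₀ + M * ε) := by
    have h := (abs_le.mp (hHle _ (Set.right_mem_Icc.mpr hle))).1
    nlinarith
  obtain ⟨y, hy, hyH⟩ := intermediate_value_Icc hle hcont ⟨hlo, hhi⟩
  have hypos : 0 < y := by linarith [hy.1]
  have hbd := hLip ε y 0 y₀ hεr (hyr y hy) (by simpa using hr) (by simpa using hr)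
  have hbd' : L * (|ε - 0| + |y - y₀|) ≤ N * ε := by
    have : |y - y₀| ≤ M * ε := abs_le.mpr ⟨by linarith [hy.1], by linarith [hy.2]⟩
    rw [sub_zero, abs_of_pos hε, hN, mul_assoc]
    exact mul_le_mul_of_nonneg_left (by linarith) hL.le
  replace hbd := hbd.trans hbd'
  have hF := (norm_fst_le _).trans hbd
  have hU := (norm_fst_le _).trans ((norm_snd_le _).trans hbd)
  have hW := (norm_fst_le _).trans ((norm_snd_le _).trans ((norm_snd_le _).trans hbd))
  have hF0 : hopfF D B₁ 0 y₀ = -(2 * y₀) := by simp only [hopfF]; ring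
  have hU0 : hopfU D B₁ 0 y₀ = 1 / √3 := by simp [hopfU]
  simp only [Prod.fst_sub, Prod.snd_sub, Real.norm_eq_abs, hF0, hU0, sub_neg_eq_add, one_div,
    inv_inv] at hF hU hW
  have hFabs := abs_le.mp hF
  have hpos : 0 < 1 + ε * hopfF D B₁ ε y := by nlinarith
  have hupos : 0 < hopfU D B₁ ε y := Real.sqrt_pos.mpr (by positivity)
  have husq : hopfU D B₁ ε y ^ 2 = (1 + ε * hopfF D B₁ ε y) / 3 := Real.sq_sqrt (by positivity)
  have hyH' : hopfH D B₁ C₁ ε y = 0 := hyH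
  rw [hopfH] at hyH'
  refine ⟨hopfA D B₁ ε y, hopfU D B₁ ε y, ?_, ?_, ?_, √(ε * y), by positivity, fun v hv => ?_⟩
  · have hs : 2 * √2 / (3 * √3) = 2 * y₀ / 3 := by rw [hy₀]; field_simp
    have : hopfA D B₁ ε y - 2 / 3 - ε * (2 * √2 / (3 * √3) - (B₁ + √3 * C₁)) =
        -(ε * ((hopfF D B₁ ε y + 2 * y₀) / 3 + C₁ * ((hopfU D B₁ ε y)⁻¹ - √3))) := by
      rw [hs]; linear_combination hyH'
    rw [this, abs_neg, abs_mul, abs_of_pos hε]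
    have h1 : |(hopfF D B₁ ε y + 2 * y₀) / 3| ≤ N * ε := by
      rw [abs_div, abs_of_pos (by norm_num : (0 : ℝ) < 3)]
      linarith
    have h2 : |C₁ * ((hopfU D B₁ ε y)⁻¹ - √3)| ≤ |C₁| * (N * ε) := by
      rw [abs_mul]; exact mul_le_mul_of_nonneg_left hW (abs_nonneg _)
    calc _ ≤ ε * (N * ε + |C₁| * (N * ε)) :=
          mul_le_mul_of_nonneg_left ((abs_add_le _ _).trans (add_le_add h1 h2)) hε.le
      _ = _ := by ring
  · have hinv : hopfU D B₁ ε y * (hopfU D B₁ ε y)⁻¹ = 1 := mul_inv_cancel₀ hupos.ne'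
    linear_combination hopfU D B₁ ε y * husq + hopfU D B₁ ε y * hyH' - ε * C₁ * hinv
  · rw [one_div]
    exact hU.trans (by nlinarith [abs_nonneg C₁])
  · refine rootMultiplicity_charPoly_hopf hD hε hypos (by rw [hv, husq]; ring) ?_
    linarith [hy.1]

/-- Lemma 3.2 (Turing / Hamiltonian–Hopf bifurcation): for `B = εB₁`, `C = εC₁`, there is a
curve `A_HH(ε) = 2/3 + ε(2√2/(3√3) − (B₁ ± √3C₁)) + O(ε²)` along which the characteristic
polynomial at the equilibrium near `±1/√3` has a purely imaginary root of algebraic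
multiplicity two. -/
theorem turing_hamiltonian_hopf (D B₁ C₁ : ℝ) (hD : 1 < D) :
    ∃ ε₀ > (0 : ℝ), ∃ K > (0 : ℝ), ∀ ε : ℝ, 0 < ε → ε < ε₀ →
      ((∃ A_HH ubar : ℝ,
        |A_HH - 2 / 3 - ε * (2 * Real.sqrt 2 / (3 * Real.sqrt 3) - (B₁ + Real.sqrt 3 * C₁))|
            ≤ K * ε ^ 2 ∧
        ubar ^ 3 - ubar * (1 - A_HH - ε * B₁) + ε * C₁ = 0 ∧
        |ubar - 1 / Real.sqrt 3| ≤ K * ε ∧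
        ∃ μ : ℝ, μ ≠ 0 ∧
          Polynomial.rootMultiplicity (Complex.I * (μ : ℂ)) (charPoly ε A_HH (ε * B₁) D ubar)
            = 2) ∧
      (∃ A_HH ubar : ℝ,
        |A_HH - 2 / 3 - ε * (2 * Real.sqrt 2 / (3 * Real.sqrt 3) - (B₁ - Real.sqrt 3 * C₁))|
            ≤ K * ε ^ 2 ∧
        ubar ^ 3 - ubar * (1 - A_HH - ε * B₁) + ε * C₁ = 0 ∧
        |ubar - (-(1 / Real.sqrt 3))| ≤ K * ε ∧
        ∃ μ : ℝ, μ ≠ 0 ∧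
          Polynomial.rootMultiplicity (Complex.I * (μ : ℂ)) (charPoly ε A_HH (ε * B₁) D ubar)
            = 2)) := by
  obtain ⟨ε₁, hε₁, K₁, hK₁, h₁⟩ := exists_hopf_curve D B₁ C₁ (by linarith)
  obtain ⟨ε₂, hε₂, K₂, hK₂, h₂⟩ := exists_hopf_curve D B₁ (-C₁) (by linarith)
  refine ⟨min ε₁ ε₂, lt_min hε₁ hε₂, max K₁ K₂, lt_max_of_lt_left hK₁, fun ε hε hlt => ⟨?_, ?_⟩⟩
  · obtain ⟨A, u, hA, hu, hu', μ, hμ, hroot⟩ := h₁ ε hε (hlt.trans_le (min_le_left _ _))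
    exact ⟨A, u, hA.trans (by gcongr; exact le_max_left _ _), hu,
      hu'.trans (by gcongr; exact le_max_left _ _), μ, hμ, hroot u rfl⟩
  · obtain ⟨A, u, hA, hu, hu', μ, hμ, hroot⟩ := h₂ ε hε (hlt.trans_le (min_le_right _ _))
    refine ⟨A, -u, ?_, by linear_combination -hu, ?_, μ, hμ, hroot (-u) (neg_sq u)⟩
    · rw [mul_neg, ← sub_eq_add_neg] at hA
      exact hA.trans (by gcongr; exact le_max_right _ _)
    · rw [← neg_sub', abs_neg]
      exact hu'.trans (by gcongr; exact le_max_right _ _)
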